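/- arXiv:2508.11542 — 2 statements merged into one kernel-verified Lean document; each statement's English description precedes it below -/
import Mathlib

section
/- Let n ≥ s ≥ 2 and let V ∈ ℝ^{n×s} have orthonormal columns, with V' ∈ ℝ^{n×(s−1)} its first s−1 columns and v ∈ ℝⁿ its last column. Let c ∈ ℝ^{s−1}, A ∈ ℝ^{(s−1)×(s−1)}, and let H : ℝ^{s−1} × ℝ^{s−1} → ℝ^{s−1} be bilinear. Let x : [0,T] → ℝⁿ be any function with x(0) = x₀, and let ŷ : [0,T] → ℝ^{s−1} satisfy ŷ'(t) = c + A ŷ(t) + H(ŷ(t), ŷ(t)) for all t ∈ [0,T] with ŷ(0) = (V')ᵀ x₀. Let z : [0,T] → ℝ^{s−1} × ℝ satisfy z'(t) = (c + A z₁(t) + H(z₁(t), z₁(t)), 0) for all t ∈ [0,T] with z(0) = (ŷ(0), vᵀx₀), where z₁ denotes the first component, and assume the reduced system has unique solutions, i.e., z₁ = ŷ. Then for every t ∈ [0,T], ‖V z(t) − x(t)‖₂² = ‖V' ŷ(t) − x(t)‖₂² + ζ(t), where ζ(t) := (vᵀx₀)(vᵀx₀ − 2 vᵀx(t)). (Proposition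 1: the error of the zero-padded expanded reduced-order model equals the error of the smaller model plus ζ.) -/
open Matrix

/-- The squared error of an orthonormal reconstruction changes, when one further coordinate `b`
is appended, by an amount independent of the other coordinates. -/
theorem sum_sq_mulVec_snoc_sub {m : Type*} [Fintype m] {d : ℕ}
    (V : Matrix m (Fin (d + 1)) ℝ) (hV : Vᵀ * V = 1) (y : Fin d → ℝ) (b : ℝ) (x : m → ℝ) :
    ∑ i, (V.mulVec (Fin.snoc y b) i - x i) ^ 2
      = ∑ i, ((∑ j, V i (Fin.castSucc j) * y j) - x i) ^ 2
        + b * (b - 2 * ∑ i, V i (Fin.last d) * x i) := by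
  have hentry (j k : Fin (d + 1)) :
      ∑ i, V i j * V i k = (1 : Matrix (Fin (d + 1)) (Fin (d + 1)) ℝ) j k := by
    rw [← hV]
    simp [Matrix.mul_apply]
  have hnorm : ∑ i, V i (Fin.last d) ^ 2 = 1 := by
    simpa [sq] using hentry (Fin.last d) (Fin.last d)
  have horth : ∑ i, V i (Fin.last d) * ∑ j, V i (Fin.castSucc j) * y j = 0 := by
    simp_rw [Finset.mul_sum, ← mul_assoc]
    rw [Finset.sum_comm]
    refine Finset.sum_eq_zero fun j _ => ?_
    rw [← Finset.sum_mul, hentry, Matrix.one_apply_ne (Fin.castSucc_lt_last j).ne', zero_mul]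
  have hexpand (i : m) : (V.mulVec (Fin.snoc y b) i - x i) ^ 2
      = ((∑ j, V i (Fin.castSucc j) * y j) - x i) ^ 2
        + 2 * b * (V i (Fin.last d) * ∑ j, V i (Fin.castSucc j) * y j)
        - 2 * b * (V i (Fin.last d) * x i) + b ^ 2 * V i (Fin.last d) ^ 2 := by
    simp only [Matrix.mulVec, dotProduct, Fin.sum_univ_castSucc, Fin.snoc_castSucc, Fin.snoc_last]
    ring
  simp_rw [hexpand, Finset.sum_add_distrib, Finset.sum_sub_distrib, Finset.sum_add_distrib,
    ← Finset.mul_sum, horth, hnorm]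
  ring

/-- **Proposition 1.** The error of the zero-padded expanded
reduced-order model equals the error of the smaller model plus
`ζ(t) = (vᵀx₀)(vᵀx₀ − 2 vᵀx(t))`.  Here `V ∈ ℝ^{n×(d+1)}` (`d = s−1 ≥ 1`) has
orthonormal columns, `V'` is its first `d` columns (`j ↦ V · (Fin.castSucc j)`)
and `v` its last column; `yh` solves the small quadratic ROM, `z` solves the
zero-padded expanded ROM, and the reduced system is assumed to have unique
solutions, i.e. the first component of `z` coincides with `yh`. -/
theorem stmt0 (n d : ℕ) (hd : 1 ≤ d) (hn : d + 1 ≤ n) (T : ℝ) (hT : 0 ≤ T)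
    (V : Matrix (Fin n) (Fin (d + 1)) ℝ) (hV : Vᵀ * V = 1)
    (c : Fin d → ℝ) (A : Matrix (Fin d) (Fin d) ℝ)
    (H : (Fin d → ℝ) →ₗ[ℝ] (Fin d → ℝ) →ₗ[ℝ] (Fin d → ℝ))
    (x : ℝ → Fin n → ℝ) (x₀ : Fin n → ℝ) (hx0 : x 0 = x₀)
    (yh : ℝ → Fin d → ℝ)
    (hyh : ∀ t ∈ Set.Icc (0 : ℝ) T,
      HasDerivAt yh (c + A.mulVec (yh t) + H (yh t) (yh t)) t)
    (hyh0 : yh 0 = fun j => ∑ i, V i (Fin.castSucc j) * x₀ i)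
    (z : ℝ → (Fin d → ℝ) × ℝ)
    (hz : ∀ t ∈ Set.Icc (0 : ℝ) T,
      HasDerivAt z (c + A.mulVec (z t).1 + H (z t).1 (z t).1, 0) t)
    (hz0 : z 0 = (yh 0, ∑ i, V i (Fin.last d) * x₀ i))
    (huniq : ∀ t ∈ Set.Icc (0 : ℝ) T, (z t).1 = yh t) :
    ∀ t ∈ Set.Icc (0 : ℝ) T,
      ∑ i, (V.mulVec (Fin.snoc (z t).1 (z t).2) i - x t i) ^ 2
        = ∑ i, ((∑ j, V i (Fin.castSucc j) * yh t j) - x t i) ^ 2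
          + (∑ i, V i (Fin.last d) * x₀ i)
            * ((∑ i, V i (Fin.last d) * x₀ i) - 2 * ∑ i, V i (Fin.last d) * x t i) := by
  intro t ht
  have hderiv (r : ℝ) (hr : r ∈ Set.Icc 0 T) : HasDerivAt (fun r => (z r).2) 0 r :=
    (hasFDerivAt_snd (p := z r)).comp_hasDerivAt r (hz r hr)
  have hconst : (z t).2 = ∑ i, V i (Fin.last d) * x₀ i := by
    have h := constant_of_has_deriv_right_zero
      (fun r hr => (hderiv r hr).continuousAt.continuousWithinAt)
      (fun r hr => (hderiv r (Set.Ico_subset_Icc_self hr)).hasDerivWithinAt) t ht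
    simpa only [hz0] using h
  rw [hconst, huniq t ht]
  exact sum_sq_mulVec_snoc_sub V hV (yh t) _ (x t)
end

section
/- Let n ≥ r ≥ 2, let V ∈ ℝ^{n×r} have orthonormal columns v₁, …, v_r, let x₁, …, x_K ∈ ℝⁿ be snapshots, and for 1 ≤ s ≤ r and 1 ≤ k ≤ K let p_s(k) := V_sᵀ x_k ∈ ℝ^s denote the projected snapshots onto the first s columns V_s of V. Suppose given trajectories x̂_s : {1,…,K} → ℝ^s for 1 ≤ s ≤ r−1 and x̂_s⁽⁰⁾ : {1,…,K} → ℝ^s for 2 ≤ s ≤ r such that: (i) Σ_{k=1}^K |x̂₁(k) − p₁(k)|² ≤ Σ_{k=1}^K |v₁ᵀx₁ − p₁(k)|²; (ii) x̂_s⁽⁰⁾(k) = (x̂_{s−1}(k), v_sᵀ x₁) for all 2 ≤ s ≤ r and all k; (iii) Σ_{k=1}^K ‖x̂_s(k) − p_s(k)‖₂² ≤ Σ_{k=1}^K ‖x̂_s⁽⁰⁾(k) − p_s(k)‖₂² for all 2 ≤ s ≤ r−1. Then Σ_{k=1}^K ‖V x̂_r⁽⁰⁾(k) − x_k‖₂²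 ≤ Σ_{k=1}^K ‖V x̄(k) − x_k‖₂², where x̄(k) := Vᵀ x₁ for all k is the constant trajectory produced by the reduced-order model whose constant, linear, and quadratic operators are all zero. (Corollary 2: the iteratively expanded initial guess of nested Operator Inference reconstructs the snapshots at least as well as the zero operators used in standard Tikhonov regularization.) -/
open Matrix

/-- For `V` with orthonormal columns, the reconstruction error of `V a` splits into the error in the
reduced coordinates and the error of the orthogonal projection, which does not depend on `a`. -/
theorem sum_mulVec_sub_sq {m n : Type*} [Fintype m] [Fintype n] [DecidableEq n]
    {V : Matrix m n ℝ} (hV : Vᵀ * V = 1) (a : n → ℝ) (y : m → ℝ) :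
    ∑ i, (V.mulVec a i - y i) ^ 2
      = ∑ j, (a j - ∑ i, V i j * y i) ^ 2
        + (∑ i, y i ^ 2 - ∑ j, (∑ i, V i j * y i) ^ 2) := by
  have hsq : ∑ i, V.mulVec a i ^ 2 = ∑ j, a j ^ 2 := by
    have h : V.mulVec a ⬝ᵥ V.mulVec a = a ⬝ᵥ a := by
      rw [dotProduct_mulVec, ← mulVec_transpose, mulVec_mulVec, hV, one_mulVec]
    simpa [dotProduct, sq] using h
  have hcross : ∑ i, V.mulVec a i * y i = ∑ j, a j * ∑ i, V i j * y i := by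
    have h : V.mulVec a ⬝ᵥ y = a ⬝ᵥ Vᵀ.mulVec y := by
      rw [dotProduct_comm, dotProduct_mulVec, ← mulVec_transpose, dotProduct_comm]
    simpa [dotProduct, mulVec] using h
  simp only [sub_sq, Finset.sum_add_distrib, Finset.sum_sub_distrib, mul_assoc, ← Finset.mul_sum]
  rw [hsq, hcross]
  ring

/-- Appending the same last coordinate to both trajectories preserves an inequality between their
squared errors. -/
theorem sum_snoc_sub_sq_le {ι : Type*} [Fintype ι] {s : ℕ} {u : ι → Fin s → ℝ}
    {w : Fin (s + 1) → ℝ} {q : ι → Fin (s + 1) → ℝ}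
    (h : ∑ k, ∑ j, (u k j - q k (Fin.castSucc j)) ^ 2
      ≤ ∑ k, ∑ j : Fin s, (w (Fin.castSucc j) - q k (Fin.castSucc j)) ^ 2) :
    ∑ k, ∑ j, ((Fin.snoc (u k) (w (Fin.last s)) : Fin (s + 1) → ℝ) j - q k j) ^ 2
      ≤ ∑ k, ∑ j, (w j - q k j) ^ 2 := by
  simp only [Fin.sum_univ_castSucc, Fin.snoc_castSucc, Fin.snoc_last, Finset.sum_add_distrib]
  gcongr

/-- **Corollary 2.** The iteratively expanded initial guess of
nested Operator Inference reconstructs the snapshots at least as well as the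
zero operators used in standard Tikhonov regularization.  Snapshots are
`x k`, `k : Fin K` (so `x₁ = x ⟨0, hK⟩`), `V` has orthonormal columns, the
projected snapshot `p_s(k)` is `j ↦ ∑ i, V i (Fin.castLE _ j) * x k i`, and
trajectories `xh s` (chosen models) and `xh0 s` (zero-padded initial guesses)
satisfy (i), (ii), (iii). -/
theorem stmt3 (n r K : ℕ) (hr : 2 ≤ r) (hn : r ≤ n) (hK : 1 ≤ K)
    (V : Matrix (Fin n) (Fin r) ℝ) (hV : Vᵀ * V = 1)
    (x : Fin K → Fin n → ℝ)
    (xh : (s : ℕ) → Fin K → Fin s → ℝ)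
    (xh0 : (s : ℕ) → Fin K → Fin s → ℝ)
    -- (i)
    (h1 : ∑ k, ∑ j : Fin 1,
        (xh 1 k j - ∑ i, V i (Fin.castLE (by omega) j) * x k i) ^ 2
      ≤ ∑ k, ∑ j : Fin 1,
        ((∑ i, V i (Fin.castLE (by omega) j) * x ⟨0, hK⟩ i)
          - ∑ i, V i (Fin.castLE (by omega) j) * x k i) ^ 2)
    -- (ii)
    (h2 : ∀ s : ℕ, ∀ _hs1 : 1 ≤ s, ∀ hsr : s + 1 ≤ r, ∀ k : Fin K,
      xh0 (s + 1) k
        = Fin.snoc (xh s k) (∑ i, V i ⟨s, by omega⟩ * x ⟨0, hK⟩ i))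
    -- (iii)
    (h3 : ∀ s : ℕ, ∀ _hs2 : 2 ≤ s, ∀ hsr : s + 1 ≤ r,
      ∑ k, ∑ j : Fin s,
        (xh s k j - ∑ i, V i (Fin.castLE (by omega) j) * x k i) ^ 2
      ≤ ∑ k, ∑ j : Fin s,
        (xh0 s k j - ∑ i, V i (Fin.castLE (by omega) j) * x k i) ^ 2) :
    ∑ k, ∑ i, (V.mulVec (xh0 r k) i - x k i) ^ 2
      ≤ ∑ k, ∑ i,
          (V.mulVec (fun j => ∑ i', V i' j * x ⟨0, hK⟩ i') i - x k i) ^ 2 := by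
  have expand : ∀ s : ℕ, 1 ≤ s → ∀ hsr : s + 1 ≤ r,
      ∑ k, ∑ j : Fin s,
          (xh s k j - ∑ i, V i (Fin.castLE (by omega) j) * x k i) ^ 2
        ≤ ∑ k, ∑ j : Fin s, ((∑ i, V i (Fin.castLE (by omega) j) * x ⟨0, hK⟩ i)
          - ∑ i, V i (Fin.castLE (by omega) j) * x k i) ^ 2 →
      ∑ k, ∑ j : Fin (s + 1),
          (xh0 (s + 1) k j - ∑ i, V i (Fin.castLE hsr j) * x k i) ^ 2
        ≤ ∑ k, ∑ j : Fin (s + 1), ((∑ i, V i (Fin.castLE hsr j) * x ⟨0, hK⟩ i)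
          - ∑ i, V i (Fin.castLE hsr j) * x k i) ^ 2 := by
    intro s hs hsr h
    simp only [h2 s hs hsr]
    exact sum_snoc_sub_sq_le (u := xh s)
      (w := fun j => ∑ i, V i (Fin.castLE hsr j) * x ⟨0, hK⟩ i)
      (q := fun k j => ∑ i, V i (Fin.castLE hsr j) * x k i) h
  have chosen : ∀ s : ℕ, 1 ≤ s → ∀ hsr : s + 1 ≤ r,
      ∑ k, ∑ j : Fin s,
          (xh s k j - ∑ i, V i (Fin.castLE (by omega) j) * x k i) ^ 2
        ≤ ∑ k, ∑ j : Fin s, ((∑ i, V i (Fin.castLE (by omega) j) * x ⟨0, hK⟩ i)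
          - ∑ i, V i (Fin.castLE (by omega) j) * x k i) ^ 2 := by
    intro s hs
    induction s, hs using Nat.le_induction with
    | base => exact fun _ => h1
    | succ s hs ih =>
      exact fun hsr => (h3 (s + 1) (by omega) hsr).trans
        (expand s hs (by omega) (ih (by omega)))
  simp only [sum_mulVec_sub_sq hV, Finset.sum_add_distrib]
  gcongr ?_ + _
  obtain ⟨t, rfl⟩ : ∃ t, r = t + 1 := ⟨r - 1, by omega⟩
  exact expand t (by omega) le_rfl (chosen t (by omega) le_rfl)
end
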